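/- A group X is polyfinite provided there exist n ∈ ℕ and an algebraic subset A of X such that for every x, y ∈ X there exist c ∈ X and an integer k with 1 ≤ k ≤ n satisfying x^k y^k ∈ c(A·A⁻¹ ∪ A⁻¹·A)c⁻¹. -/

import Mathlib

open Cardinal Pointwise

universe u

namespace ZeroClosedPaper

/-- The value of the semigroup polynomial with coefficient list `a = [a₀, a₁, …, aₙ]`
(coefficients in `X¹ = WithOne X`) at the point `x`, i.e. `a₀xa₁x⋯xaₙ`,
computed in the monoid `WithOne X`. Its degree (the number of occurrences of `x`)
is `a.length - 1`. -/
def polyVal {X : Type*} [Semigroup X] (a : List (WithOne X)) (x : X) : WithOne X :=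
  match a with
  | [] => 1
  | a₀ :: rest => a₀ * (rest.map (fun ai => (x : WithOne X) * ai)).prod

/-- A subset `A` of a semigroup `X` is algebraic if
`A = {x ∈ X : a₀xa₁⋯xaₙ = b}` for some `n ≥ 1`, `b ∈ X` and `a₀,…,aₙ ∈ X¹`. -/
def IsAlgebraicSet {X : Type*} [Semigroup X] (A : Set X) : Prop :=
  ∃ (a : List (WithOne X)) (b : X), 2 ≤ a.length ∧
    A = {x : X | polyVal a x = (b : WithOne X)}

/-- The polyboundedness number `cov(A_X)`: the smallest cardinality of a cover of `X`
by algebraic subsets of `X`. -/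
noncomputable def covA (X : Type*) [Semigroup X] : Cardinal :=
  sInf {c : Cardinal | ∃ C : Set (Set X), (∀ A ∈ C, IsAlgebraicSet A) ∧
    ⋃₀ C = Set.univ ∧ Cardinal.mk ↥C = c}

/-- A subset `S` of a semigroup `X` is polybounded in `X` if it can be covered by
finitely many algebraic subsets of `X`. -/
def PolyboundedIn {X : Type*} [Semigroup X] (S : Set X) : Prop :=
  ∃ C : Set (Set X), C.Finite ∧ (∀ A ∈ C, IsAlgebraicSet A) ∧ S ⊆ ⋃₀ C

/-- A semigroup is polybounded if it admits a finite cover by algebraic sets. -/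
def Polybounded (X : Type*) [Semigroup X] : Prop :=
  PolyboundedIn (Set.univ : Set X)

/-- A semigroup `X` is polyfinite if there are `n ∈ ℕ` and a finite `F ⊆ X` such that
for all `x, y ∈ X` some semigroup polynomial `f` of degree `≤ n` has `f(x), f(y) ∈ F`. -/
def Polyfinite (X : Type*) [Semigroup X] : Prop :=
  ∃ (n : ℕ) (F : Set X), F.Finite ∧ ∀ x y : X, ∃ a : List (WithOne X),
    2 ≤ a.length ∧ a.length ≤ n + 1 ∧
    (∃ u ∈ F, polyVal a x = (u : WithOne X)) ∧
    (∃ v ∈ F, polyVal a y = (v : WithOne X))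

/-- A semigroup `X` is zero-closed if `X` is closed in its `0`-extension
`X⁰ = WithZero X` endowed with any Hausdorff semigroup topology. -/
def ZeroClosed (X : Type*) [Semigroup X] : Prop :=
  ∀ τ : TopologicalSpace (WithZero X),
    @T2Space (WithZero X) τ → @ContinuousMul (WithZero X) τ _ →
    @IsClosed (WithZero X) τ (Set.range ((↑) : X → WithZero X))

/-- `d` is a pseudometric. -/
def IsPseudometric {X : Type*} (d : X → X → ℝ) : Prop :=
  (∀ x, d x x = 0) ∧ (∀ x y, d x y = d y x) ∧ (∀ x y z, d x z ≤ d x y + d y z)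

/-- `d` is subinvariant: `d(axb, ayb) ≤ d(x,y)` for all `a, b ∈ X¹`
(equivalently, `d` is both left- and right-nonexpansive under translations). -/
def Subinvariant {X : Type*} [Semigroup X] (d : X → X → ℝ) : Prop :=
  (∀ a x y : X, d (a * x) (a * y) ≤ d x y) ∧
  (∀ b x y : X, d (x * b) (y * b) ≤ d x y)

/-- `d` is separable: some countable set is `d`-dense. -/
def SeparablePseudometric {X : Type*} (d : X → X → ℝ) : Prop :=
  ∃ C : Set X, C.Countable ∧ ∀ x : X, ∀ ε : ℝ, 0 < ε → ∃ c ∈ C, d x c < ε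

/-- `cov(M)`: the smallest cardinality of a cover of the real line by meager sets. -/
noncomputable def covMeager : Cardinal :=
  sInf {c : Cardinal | ∃ S : Set (Set ℝ), (∀ A ∈ S, IsMeagre A) ∧
    ⋃₀ S = Set.univ ∧ Cardinal.mk ↥S = c}

/-- `cov(N̄)`: the smallest cardinality of a cover of the real line by closed
Lebesgue-null sets. -/
noncomputable def covClosedNull : Cardinal :=
  sInf {c : Cardinal | ∃ S : Set (Set ℝ),
    (∀ A ∈ S, IsClosed A ∧ MeasureTheory.volume A = 0) ∧
    ⋃₀ S = Set.univ ∧ Cardinal.mk ↥S = c}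

/-- A topological space is power-Lindelöf if each finite power is Lindelöf. -/
def PowerLindelof (Y : Type*) [TopologicalSpace Y] : Prop :=
  ∀ n : ℕ, LindelofSpace (Fin n → Y)

/-- `I` is an ideal of the semigroup `X`. -/
def IsIdeal {X : Type*} [Semigroup X] (I : Set X) : Prop :=
  ∀ x ∈ I, ∀ a : X, x * a ∈ I ∧ a * x ∈ I

theorem polyVal_singleton {X : Type*} [Semigroup X] (a : WithOne X) (x : X) :
    polyVal [a] x = a := by
  simp [polyVal]

theorem polyVal_cons_cons {X : Type*} [Semigroup X] (a b : WithOne X) (l : List (WithOne X))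
    (x : X) : polyVal (a :: b :: l) x = a * x * polyVal (b :: l) x := by
  simp [polyVal, mul_assoc]

/-- `φ` is a semigroup polynomial of degree `d`, where degree `0` (constants) is allowed. -/
def IsPolyOfDegree {X : Type*} [Semigroup X] (d : ℕ) (φ : X → WithOne X) : Prop :=
  ∃ a : List (WithOne X), a.length = d + 1 ∧ ∀ x, polyVal a x = φ x

theorem isPolyOfDegree_const {X : Type*} [Semigroup X] (c : WithOne X) :
    IsPolyOfDegree 0 (fun _ : X => c) :=
  ⟨[c], rfl, polyVal_singleton c⟩

theorem isPolyOfDegree_coe {X : Type*} [Semigroup X] :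
    IsPolyOfDegree 1 (fun x : X => (x : WithOne X)) :=
  ⟨[1, 1], rfl, fun x => by simp [polyVal]⟩

theorem IsPolyOfDegree.mul {X : Type*} [Semigroup X] {d e : ℕ} {φ ψ : X → WithOne X}
    (hφ : IsPolyOfDegree d φ) (hψ : IsPolyOfDegree e ψ) :
    IsPolyOfDegree (d + e) (fun x => φ x * ψ x) := by
  obtain ⟨a, ha, hφ⟩ := hφ
  induction a generalizing d φ with
  | nil => simp at ha
  | cons a₀ a ih =>
    cases a with
    | nil =>
      obtain rfl : d = 0 := by simpa using ha.symm
      obtain ⟨b, hb, hψ⟩ := hψ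
      cases b with
      | nil => simp at hb
      | cons b₀ b =>
        refine ⟨(a₀ * b₀) :: b, by simpa using hb, fun x => ?_⟩
        simp [← hφ, ← hψ, polyVal, mul_assoc]
    | cons a₁ a =>
      obtain ⟨d, rfl⟩ : ∃ d', d = d' + 1 := ⟨a.length, by simpa using ha.symm⟩
      obtain ⟨c, hc, hcx⟩ := ih (d := d) (by simpa using ha) (fun _ => rfl)
      cases c with
      | nil => simp at hc
      | cons c₀ c =>
        refine ⟨a₀ :: c₀ :: c, by rw [List.length_cons, hc]; omega, fun x => ?_⟩
        simp only [polyVal_cons_cons, hcx, ← hφ, mul_assoc]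

theorem isPolyOfDegree_pow {X : Type*} [Semigroup X] (k : ℕ) :
    IsPolyOfDegree k (fun x : X => (x : WithOne X) ^ k) := by
  induction k with
  | zero => simpa using isPolyOfDegree_const (X := X) 1
  | succ k ih => simpa only [pow_succ] using ih.mul isPolyOfDegree_coe

theorem IsPolyOfDegree.polyVal_comp {X : Type*} [Semigroup X] {m : ℕ} {g : X → X}
    (hg : IsPolyOfDegree m (fun x => (g x : WithOne X))) {a : List (WithOne X)} (ha : a ≠ []) :
    IsPolyOfDegree ((a.length - 1) * m) (fun x => polyVal a (g x)) := by
  induction a with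
  | nil => exact absurd rfl ha
  | cons a₀ a ih =>
    cases a with
    | nil => simpa [polyVal_singleton] using isPolyOfDegree_const (X := X) a₀
    | cons a₁ a =>
      have h := ((isPolyOfDegree_const a₀).mul hg).mul (ih (by simp))
      simp only [polyVal_cons_cons]
      convert h using 1
      simp only [List.length_cons, Nat.add_sub_cancel]
      ring

theorem coe_pow_withOne {X : Type*} [Monoid X] (x : X) {k : ℕ} (hk : 1 ≤ k) :
    ((x ^ k : X) : WithOne X) = (x : WithOne X) ^ k := by
  induction k, hk using Nat.le_induction with
  | base => simp
  | succ k _ ih => rw [pow_succ, pow_succ, WithOne.coe_mul, ih]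

theorem isPolyOfDegree_mul_pow_mul {X : Type*} [Monoid X] (u v : X) {k : ℕ} (hk : 1 ≤ k) :
    IsPolyOfDegree k (fun x : X => ((u * x ^ k * v : X) : WithOne X)) := by
  have h := ((isPolyOfDegree_const (u : WithOne X)).mul (isPolyOfDegree_pow k)).mul
    (isPolyOfDegree_const (v : WithOne X))
  simpa [WithOne.coe_mul, coe_pow_withOne _ hk] using h

/-- If `x ^ k * y⁻¹ ^ k` is conjugate to an element of `A * A⁻¹ ∪ A⁻¹ * A`, then some polynomial
`z ↦ u * z ^ k * v` maps both `x` and `y` into `A`. -/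
theorem exists_mul_pow_mul_mem {X : Type*} [Group X] {A : Set X} {x y c : X} {k : ℕ}
    (h : x ^ k * y⁻¹ ^ k ∈ (fun s => c * s * c⁻¹) '' (A * A⁻¹ ∪ A⁻¹ * A)) :
    ∃ u v : X, u * x ^ k * v ∈ A ∧ u * y ^ k * v ∈ A := by
  obtain ⟨s, hs, hsc⟩ := h
  have hs' : s = c⁻¹ * (x ^ k * y⁻¹ ^ k) * c := by
    rw [← hsc]
    group
  rcases hs with hs | hs
  · obtain ⟨a, ha, b, hb, hab⟩ := Set.mem_mul.1 hs
    refine ⟨c⁻¹, (x ^ k)⁻¹ * c * a, by simpa [mul_assoc] using ha, ?_⟩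
    have hb' : c⁻¹ * y ^ k * ((x ^ k)⁻¹ * c * a) = b⁻¹ := by
      rw [eq_inv_mul_of_mul_eq (hab.trans hs')]
      simp [mul_assoc]
    rw [hb']
    exact hb
  · obtain ⟨a, ha, b, hb, hab⟩ := Set.mem_mul.1 hs
    refine ⟨a⁻¹ * c⁻¹, (y ^ k)⁻¹ * c, ?_, by simpa [mul_assoc] using ha⟩
    have hb' : a⁻¹ * c⁻¹ * x ^ k * ((y ^ k)⁻¹ * c) = b := by
      rw [eq_inv_mul_of_mul_eq (hab.trans hs')]
      simp [mul_assoc]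
    rw [hb']
    exact hb

/-- A group `X` is polyfinite provided there are `n ∈ ℕ` and an
algebraic set `A ⊆ X` such that for all `x, y ∈ X` there are `c ∈ X` and
`1 ≤ k ≤ n` with `x^k y^k ∈ c(AA⁻¹ ∪ A⁻¹A)c⁻¹`. -/
theorem statement13 {X : Type u} [Group X]
    (h : ∃ (n : ℕ) (A : Set X), IsAlgebraicSet A ∧ ∀ x y : X, ∃ (c : X) (k : ℕ),
      1 ≤ k ∧ k ≤ n ∧
      x ^ k * y ^ k ∈ (fun s => c * s * c⁻¹) '' (A * A⁻¹ ∪ A⁻¹ * A)) :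
    Polyfinite X := by
  obtain ⟨n, A, ⟨a, b, ha, rfl⟩, h⟩ := h
  refine ⟨(a.length - 1) * n, {b}, Set.finite_singleton b, fun x y => ?_⟩
  obtain ⟨c, k, hk, hkn, hxy⟩ := h x y⁻¹
  obtain ⟨u, v, hx, hy⟩ := exists_mul_pow_mul_mem hxy
  obtain ⟨p, hp, hpv⟩ := (isPolyOfDegree_mul_pow_mul u v hk).polyVal_comp
    (List.ne_nil_of_length_pos (by omega : 0 < a.length))
  have hpos : 0 < (a.length - 1) * k := Nat.mul_pos (by omega) hk
  have hle : (a.length - 1) * k ≤ (a.length - 1) * n := Nat.mul_le_mul_left _ hkn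
  exact ⟨p, by omega, by omega, ⟨b, rfl, (hpv x).trans hx⟩, ⟨b, rfl, (hpv y).trans hy⟩⟩

end ZeroClosedPaper
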